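/- Let μ be a random vector in ℝ^d whose moments of all orders exist, let ζ be a centered Gaussian random vector in ℝ^d with covariance matrix R independent of μ, and set X = μ + ζ. For any multiset A = {α₁,…,α_{2N}} of 2N indices with 1 ≤ α_i ≤ d, E[X_A] = ∑_{k=0}^{N} ∑_{S ⊆ A, |S| = 2k} E[μ_S] · ∑_{σ∈Π(A∖S)} ∏_{pairs (i,j) of σ} E[ζ_{α_i} ζ_{α_j}], where the inner sum over S runs over all sub-multisets of A (subsets of the index positions) of cardinality 2k. -/

import Mathlib

open MeasureTheory ProbabilityTheory Matrix Finset
open scoped Classical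

/-- The centered `d`-variate Gaussian density with covariance matrix `R`:
`φ_R(x) = |2πR|^{-1/2} exp(-½ xᵀ R⁻¹ x)`. -/
noncomputable def gaussianPdf {d : ℕ} (R : Matrix (Fin d) (Fin d) ℝ) (x : Fin d → ℝ) : ℝ :=
  (Real.sqrt ((2 * Real.pi) ^ d * R.det))⁻¹ * Real.exp (-(x ⬝ᵥ (R⁻¹ *ᵥ x)) / 2)

/-- The centered Gaussian measure on `ℝ^d` with (positive definite) covariance matrix `R`. -/
noncomputable def gaussianMeasure {d : ℕ} (R : Matrix (Fin d) (Fin d) ℝ) :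
    Measure (Fin d → ℝ) :=
  volume.withDensity fun x => ENNReal.ofReal (gaussianPdf R x)

/-- Pairings of a finite set `B` of index positions, encoded as fixed-point-free (on `B`)
involutions of `Fin m` that fix the complement of `B` pointwise. -/
noncomputable def pairingsOn {m : ℕ} (B : Finset (Fin m)) : Finset (Equiv.Perm (Fin m)) :=
  Finset.univ.filter fun σ =>
    (∀ i, σ (σ i) = i) ∧ (∀ i ∈ B, σ i ≠ i ∧ σ i ∈ B) ∧ ∀ i ∉ B, σ i = i

/-- The Isserlis pairing sum `∑_{σ∈Π(B)} ∏_{pairs (i,j) of σ} C (α i) (α j)` over the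
set `B` of index positions, where `C i j` stands for the second moment `E[X_i X_j]`. -/
noncomputable def pairSum {d m : ℕ} (C : Fin d → Fin d → ℝ) (α : Fin m → Fin d)
    (B : Finset (Fin m)) : ℝ :=
  ∑ σ ∈ pairingsOn B, ∏ i ∈ B.filter (fun i => i < σ i), C (α i) (α (σ i))

theorem pairingsOn_empty {m : ℕ} : pairingsOn (∅ : Finset (Fin m)) = {1} := by
  ext σ
  simp only [pairingsOn, Finset.mem_filter, Finset.mem_univ, true_and, Finset.notMem_empty,
    false_imp_iff, implies_true, not_false_eq_true, true_imp_iff, Finset.mem_singleton]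
  exact ⟨fun h => Equiv.ext h.2, by rintro rfl; simp⟩

theorem pairSum_empty {d m : ℕ} (C : Fin d → Fin d → ℝ) (α : Fin m → Fin d) :
    pairSum C α ∅ = 1 := by
  simp [pairSum, pairingsOn_empty]

theorem swap_mul_mem_pairingsOn_erase {m : ℕ} {B : Finset (Fin m)} {i j : Fin m}
    {σ : Equiv.Perm (Fin m)} (hσ : σ ∈ pairingsOn B) (hi : i ∈ B) (hj : σ i = j) :
    Equiv.swap i j * σ ∈ pairingsOn ((B.erase i).erase j) := by
  simp only [pairingsOn, Finset.mem_filter, Finset.mem_univ, true_and, Equiv.Perm.mul_apply,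
    Finset.mem_erase] at hσ ⊢
  obtain ⟨h1, h2, h3⟩ := hσ
  have hinj := σ.injective
  refine ⟨fun k => ?_, fun k hk => ?_, fun k hk => ?_⟩ <;>
  grind [Function.Injective]

theorem swap_mul_mem_pairingsOn {m : ℕ} {B : Finset (Fin m)} {i j : Fin m}
    {τ : Equiv.Perm (Fin m)} (hτ : τ ∈ pairingsOn ((B.erase i).erase j)) (hi : i ∈ B)
    (hj : j ∈ B) (hij : j ≠ i) :
    Equiv.swap i j * τ ∈ pairingsOn B ∧ (Equiv.swap i j * τ) i = j := by
  simp only [pairingsOn, Finset.mem_filter, Finset.mem_univ, true_and, Equiv.Perm.mul_apply,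
    Finset.mem_erase] at hτ ⊢
  obtain ⟨h1, h2, h3⟩ := hτ
  have hinj := τ.injective
  refine ⟨⟨fun k => ?_, fun k hk => ?_, fun k hk => ?_⟩, ?_⟩ <;>
  grind [Function.Injective]

theorem prod_swap_mul_pairing {m : ℕ} {B : Finset (Fin m)} {i j : Fin m}
    {τ : Equiv.Perm (Fin m)} (hτ : τ ∈ pairingsOn ((B.erase i).erase j)) (hi : i ∈ B)
    (hmin : ∀ k ∈ B, i ≤ k) (hj : j ∈ B) (hij : j ≠ i) (F : Fin m → Fin m → ℝ) :
    ∏ k ∈ B with k < (Equiv.swap i j * τ) k, F k ((Equiv.swap i j * τ) k) =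
      F i j * ∏ k ∈ (B.erase i).erase j with k < τ k, F k (τ k) := by
  simp only [pairingsOn, Finset.mem_filter, Finset.mem_univ, true_and, Finset.mem_erase] at hτ
  obtain ⟨h1, h2, h3⟩ := hτ
  have hτi : τ i = i := h3 i (by simp)
  have hτj : τ j = j := h3 j (by simp)
  have hlt : i < j := lt_of_le_of_ne (hmin j hj) hij.symm
  have hB : B.filter (fun k => k < (Equiv.swap i j * τ) k) =
      insert i (((B.erase i).erase j).filter fun k => k < τ k) := by
    ext k
    simp only [Equiv.Perm.mul_apply, Finset.mem_filter, Finset.mem_insert, Finset.mem_erase]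
    grind
  rw [hB, Finset.prod_insert (by simp)]
  congr 1
  · simp [hτi]
  · refine Finset.prod_congr rfl fun k hk => ?_
    simp only [Finset.mem_filter, Finset.mem_erase] at hk
    have := h2 k ⟨hk.1.1, hk.1.2.1, hk.1.2.2⟩
    rw [Equiv.Perm.mul_apply, Equiv.swap_apply_of_ne_of_ne this.2.2.1 this.2.1]

/-- Expansion of the pairing sum along the partner of the smallest index. -/
theorem pairSum_eq_sum_erase {d m : ℕ} (C : Fin d → Fin d → ℝ) (α : Fin m → Fin d)
    {B : Finset (Fin m)} {i : Fin m} (hi : i ∈ B) (hmin : ∀ k ∈ B, i ≤ k) :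
    pairSum C α B =
      ∑ j ∈ B.erase i, C (α i) (α j) * pairSum C α ((B.erase i).erase j) := by
  have hmaps : ∀ σ ∈ pairingsOn B, σ i ∈ B.erase i := by
    intro σ hσ
    simp only [pairingsOn, Finset.mem_filter, Finset.mem_univ, true_and] at hσ
    exact Finset.mem_erase.2 (hσ.2.1 i hi)
  rw [pairSum, ← Finset.sum_fiberwise_of_maps_to hmaps]
  refine Finset.sum_congr rfl fun j hj => ?_
  obtain ⟨hij, hjB⟩ := Finset.mem_erase.1 hj
  rw [pairSum, Finset.mul_sum]
  refine Finset.sum_nbij' (fun σ => Equiv.swap i j * σ) (fun τ => Equiv.swap i j * τ)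
    (fun σ hσ => ?_) (fun τ hτ => ?_) (fun σ _ => ?_) (fun τ _ => ?_) (fun σ hσ => ?_)
  · rw [Finset.mem_filter] at hσ
    exact swap_mul_mem_pairingsOn_erase hσ.1 hi hσ.2
  · exact Finset.mem_filter.2 (swap_mul_mem_pairingsOn hτ hi hjB hij)
  · simp
  · simp
  · rw [Finset.mem_filter] at hσ
    have h := prod_swap_mul_pairing (swap_mul_mem_pairingsOn_erase hσ.1 hi hσ.2) hi hmin hjB hij
      (fun k l => C (α k) (α l))
    rwa [← mul_assoc, Equiv.swap_mul_self, one_mul] at h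

theorem pairSum_eq_zero_of_odd_card {d m : ℕ} (C : Fin d → Fin d → ℝ) (α : Fin m → Fin d)
    (B : Finset (Fin m)) (hB : Odd B.card) : pairSum C α B = 0 := by
  induction B using Finset.strongInduction with
  | H B ih =>
    have hne : B.Nonempty := Finset.card_pos.1 hB.pos
    rw [pairSum_eq_sum_erase C α (B.min'_mem hne) fun k hk => B.min'_le k hk]
    refine Finset.sum_eq_zero fun j hj => ?_
    rw [ih, mul_zero]
    · exact (Finset.erase_subset _ _).trans_ssubset (Finset.erase_ssubset (B.min'_mem hne))
    · have h1 := Finset.card_erase_add_one hj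
      have h2 := Finset.card_erase_add_one (B.min'_mem hne)
      grind

theorem dotProduct_inv_mulVec_add_smul_col {d : ℕ} {R : Matrix (Fin d) (Fin d) ℝ}
    (hR : R.PosDef) (x : Fin d → ℝ) (i : Fin d) (t : ℝ) :
    (x + t • R.col i) ⬝ᵥ (R⁻¹ *ᵥ (x + t • R.col i)) =
      x ⬝ᵥ (R⁻¹ *ᵥ x) + 2 * t * x i + t ^ 2 * R i i := by
  have hdet : IsUnit R.det := (Matrix.isUnit_iff_isUnit_det R).1 hR.isUnit
  have hcol : R⁻¹ *ᵥ R.col i = Pi.single i 1 := by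
    rw [← Matrix.mulVec_single_one, Matrix.mulVec_mulVec, Matrix.nonsing_inv_mul _ hdet,
      Matrix.one_mulVec]
  have hsymm : R⁻¹ᵀ = R⁻¹ := by
    simpa [Matrix.IsHermitian] using hR.isHermitian.inv
  have hcross : R.col i ⬝ᵥ (R⁻¹ *ᵥ x) = x i := by
    rw [Matrix.dotProduct_mulVec, ← Matrix.mulVec_transpose, hsymm, hcol]
    simp
  rw [Matrix.mulVec_add, Matrix.mulVec_smul, hcol, dotProduct_add, add_dotProduct,
    add_dotProduct, smul_dotProduct, smul_dotProduct, hcross]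
  simp
  ring

theorem sq_le_mul_dotProduct_inv_mulVec {d : ℕ} {R : Matrix (Fin d) (Fin d) ℝ}
    (hR : R.PosDef) (x : Fin d → ℝ) (i : Fin d) :
    x i ^ 2 ≤ R i i * (x ⬝ᵥ (R⁻¹ *ᵥ x)) := by
  have hpos : 0 < R i i := hR.diag_pos
  have h := hR.inv.posSemidef.dotProduct_mulVec_nonneg (x + (-(x i / R i i)) • R.col i)
  rw [star_trivial, dotProduct_inv_mulVec_add_smul_col hR] at h
  have h2 := mul_nonneg hpos.le h
  have h3 : R i i * (x ⬝ᵥ (R⁻¹ *ᵥ x) + 2 * (-(x i / R i i)) * x i +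
      (-(x i / R i i)) ^ 2 * R i i) = R i i * (x ⬝ᵥ (R⁻¹ *ᵥ x)) - x i ^ 2 := by
    field_simp
    ring
  linarith

theorem exists_pos_mul_sum_sq_le_dotProduct_inv_mulVec {d : ℕ} {R : Matrix (Fin d) (Fin d) ℝ}
    (hR : R.PosDef) :
    ∃ c > 0, ∀ x : Fin d → ℝ, c * ∑ i, x i ^ 2 ≤ x ⬝ᵥ (R⁻¹ *ᵥ x) := by
  have htr : 0 ≤ ∑ i, R i i := Finset.sum_nonneg fun i _ => hR.diag_pos.le
  refine ⟨(1 + ∑ i, R i i)⁻¹, by positivity, fun x => ?_⟩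
  rw [inv_mul_le_iff₀ (by positivity), add_mul, Finset.sum_mul, one_mul]
  have hnn : 0 ≤ x ⬝ᵥ (R⁻¹ *ᵥ x) := by
    simpa using hR.inv.posSemidef.dotProduct_mulVec_nonneg x
  have := Finset.sum_le_sum fun i (_ : i ∈ Finset.univ) => sq_le_mul_dotProduct_inv_mulVec hR x i
  linarith

theorem continuous_gaussianPdf {d : ℕ} (R : Matrix (Fin d) (Fin d) ℝ) :
    Continuous (gaussianPdf R) := by
  unfold gaussianPdf
  fun_prop

theorem gaussianPdf_nonneg {d : ℕ} (R : Matrix (Fin d) (Fin d) ℝ) (x : Fin d → ℝ) :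
    0 ≤ gaussianPdf R x := by
  unfold gaussianPdf
  positivity

theorem integrable_pow_mul_exp_neg_mul_sq {b : ℝ} (hb : 0 < b) (n : ℕ) :
    Integrable fun x : ℝ => x ^ n * Real.exp (-b * x ^ 2) := by
  have h : (-1 : ℝ) < n := by
    have : (0 : ℝ) ≤ n := n.cast_nonneg
    linarith
  simpa using integrable_rpow_mul_exp_neg_mul_sq hb h

theorem integrable_prod_mul_gaussianPdf {d : ℕ} {ι : Type*} {R : Matrix (Fin d) (Fin d) ℝ}
    (hR : R.PosDef) (α : ι → Fin d) (B : Finset ι) :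
    Integrable fun x : Fin d → ℝ => (∏ j ∈ B, x (α j)) * gaussianPdf R x := by
  obtain ⟨c, hc, hbound⟩ := exists_pos_mul_sum_sq_le_dotProduct_inv_mulVec hR
  have hintegrable : Integrable fun x : Fin d → ℝ =>
      ∏ i, (x i ^ (B.filter fun j => α j = i).card * Real.exp (-(c / 2) * x i ^ 2)) :=
    Integrable.fintype_prod fun i => integrable_pow_mul_exp_neg_mul_sq (by positivity) _
  refine (hintegrable.const_mul (Real.sqrt ((2 * Real.pi) ^ d * R.det))⁻¹).mono
    ((by fun_prop : Continuous fun x : Fin d → ℝ => ∏ j ∈ B, x (α j)).mul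
      (continuous_gaussianPdf R)).aestronglyMeasurable (Filter.Eventually.of_forall fun x => ?_)
  have hmono : ∏ i, x i ^ (B.filter fun j => α j = i).card = ∏ j ∈ B, x (α j) := by
    rw [← Finset.prod_fiberwise B α]
    refine Finset.prod_congr rfl fun i _ => ?_
    rw [← Finset.prod_const]
    exact Finset.prod_congr rfl fun j hj => by rw [(Finset.mem_filter.1 hj).2]
  rw [Finset.prod_mul_distrib, hmono, ← Real.exp_sum, ← Finset.mul_sum, gaussianPdf,
    mul_left_comm, norm_mul, norm_mul, norm_mul _ (_ * _), norm_mul]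
  gcongr
  rw [Real.norm_of_nonneg (Real.exp_nonneg _), Real.norm_of_nonneg (Real.exp_nonneg _)]
  gcongr
  linarith [hbound x]

theorem hasLineDerivAt_gaussianPdf {d : ℕ} {R : Matrix (Fin d) (Fin d) ℝ} (hR : R.PosDef)
    (x : Fin d → ℝ) (i : Fin d) :
    HasLineDerivAt ℝ (gaussianPdf R) (-(x i * gaussianPdf R x)) x (R.col i) := by
  unfold HasLineDerivAt gaussianPdf
  simp only [dotProduct_inv_mulVec_add_smul_col hR]
  have h : HasDerivAt (fun t : ℝ => -(x ⬝ᵥ (R⁻¹ *ᵥ x) + 2 * t * x i + t ^ 2 * R i i) / 2)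
      (-(x i)) 0 := by
    have h1 := (((hasDerivAt_id (0 : ℝ)).const_mul 2).mul_const (x i)).const_add
      (x ⬝ᵥ (R⁻¹ *ᵥ x))
    have h2 := ((hasDerivAt_pow 2 (0 : ℝ)).mul_const (R i i))
    convert! (h1.add h2).neg.div_const 2 using 1
    simp
    ring
  convert! (h.exp.const_mul (Real.sqrt ((2 * Real.pi) ^ d * R.det))⁻¹) using 1
  simp
  ring

/-- Gaussian integration by parts for a monomial. -/
theorem integral_mul_prod_mul_gaussianPdf {d : ℕ} {ι : Type*} [DecidableEq ι]
    {R : Matrix (Fin d) (Fin d) ℝ} (hR : R.PosDef) (i : Fin d) (α : ι → Fin d) (B : Finset ι) :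
    ∫ x : Fin d → ℝ, x i * (∏ j ∈ B, x (α j)) * gaussianPdf R x =
      ∑ j ∈ B, R i (α j) * ∫ x : Fin d → ℝ, (∏ k ∈ B.erase j, x (α k)) * gaussianPdf R x := by
  have hfg := integrable_prod_mul_gaussianPdf hR α B
  have hfg' : Integrable fun x : Fin d → ℝ =>
      (∏ j ∈ B, x (α j)) * -(x i * gaussianPdf R x) := by
    have h := integrable_prod_mul_gaussianPdf hR (fun o : Option ι => o.elim i α)
      (Finset.insertNone B)
    refine h.neg.congr (Filter.Eventually.of_forall fun x => ?_)
    simp [Finset.prod_insertNone]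
    ring
  have hterm (j : ι) : Integrable fun x : Fin d → ℝ =>
      (∏ k ∈ B.erase j, x (α k)) * R i (α j) * gaussianPdf R x := by
    refine ((integrable_prod_mul_gaussianPdf hR α (B.erase j)).const_mul (R i (α j))).congr
      (Filter.Eventually.of_forall fun x => ?_)
    ring
  have hf'g : Integrable fun x : Fin d → ℝ =>
      (∑ j ∈ B, (∏ k ∈ B.erase j, x (α k)) * R i (α j)) * gaussianPdf R x := by
    simp only [Finset.sum_mul]
    exact integrable_finsetSum _ fun j _ => hterm j
  have hsymm (j : Fin d) : R j i = R i j := by simpa using hR.isHermitian.apply i j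
  have hderiv (x : Fin d → ℝ) : HasLineDerivAt ℝ (fun x : Fin d → ℝ => ∏ j ∈ B, x (α j))
      (∑ j ∈ B, (∏ k ∈ B.erase j, x (α k)) * R i (α j)) x (R.col i) := by
    have h (j : ι) (_ : j ∈ B) : HasDerivAt (fun t : ℝ => x (α j) + t * R (α j) i)
        (R i (α j)) 0 := by
      simpa [hsymm] using ((hasDerivAt_id (0 : ℝ)).mul_const (R (α j) i)).const_add (x (α j))
    simpa [HasLineDerivAt] using HasDerivAt.fun_finsetProd h
  have key := integral_bilinear_hasLineDerivAt_right_eq_neg_left_of_integrable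
    (B := ContinuousLinearMap.mul ℝ ℝ) (μ := (volume : Measure (Fin d → ℝ)))
    hf'g hfg' hfg (fun x _ => hderiv x) (fun x _ => hasLineDerivAt_gaussianPdf hR x i)
  simp only [ContinuousLinearMap.mul_apply', mul_neg, integral_neg, neg_inj, Finset.sum_mul]
    at key
  rw [integral_finsetSum _ fun j _ => hterm j] at key
  calc _ = _ := integral_congr_ae (Filter.Eventually.of_forall fun x => by ring)
    _ = _ := key
    _ = _ := Finset.sum_congr rfl fun j _ => by
      rw [← integral_const_mul]
      exact integral_congr_ae (Filter.Eventually.of_forall fun x => by ring)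

theorem integral_gaussianMeasure {d : ℕ} (R : Matrix (Fin d) (Fin d) ℝ) (f : (Fin d → ℝ) → ℝ) :
    ∫ x, f x ∂gaussianMeasure R = ∫ x, f x * gaussianPdf R x := by
  rw [gaussianMeasure, integral_withDensity_eq_integral_toReal_smul
    (continuous_gaussianPdf R).measurable.ennreal_ofReal (by simp)]
  simp [ENNReal.toReal_ofReal (gaussianPdf_nonneg R _), mul_comm]

theorem integrable_prod_gaussianMeasure {d : ℕ} {ι : Type*} {R : Matrix (Fin d) (Fin d) ℝ}
    (hR : R.PosDef) (α : ι → Fin d) (B : Finset ι) :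
    Integrable (fun x : Fin d → ℝ => ∏ j ∈ B, x (α j)) (gaussianMeasure R) := by
  rw [gaussianMeasure, integrable_withDensity_iff_integrable_smul'
    (continuous_gaussianPdf R).measurable.ennreal_ofReal (by simp)]
  simpa [ENNReal.toReal_ofReal (gaussianPdf_nonneg R _), mul_comm] using
    integrable_prod_mul_gaussianPdf hR α B

theorem integral_mul_prod_gaussianMeasure {d : ℕ} {ι : Type*} [DecidableEq ι]
    {R : Matrix (Fin d) (Fin d) ℝ} (hR : R.PosDef) (i : Fin d) (α : ι → Fin d) (B : Finset ι) :
    ∫ x : Fin d → ℝ, x i * (∏ j ∈ B, x (α j)) ∂gaussianMeasure R =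
      ∑ j ∈ B, R i (α j) * ∫ x : Fin d → ℝ, ∏ k ∈ B.erase j, x (α k) ∂gaussianMeasure R := by
  simp only [integral_gaussianMeasure, integral_mul_prod_mul_gaussianPdf hR]

theorem integral_mul_gaussianMeasure {d : ℕ} {R : Matrix (Fin d) (Fin d) ℝ} (hR : R.PosDef)
    [IsProbabilityMeasure (gaussianMeasure R)] (i j : Fin d) :
    ∫ x : Fin d → ℝ, x i * x j ∂gaussianMeasure R = R i j := by
  simpa using integral_mul_prod_gaussianMeasure hR i (fun _ : Unit => j) Finset.univ

/-- **Isserlis' theorem** for a centered Gaussian measure. -/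
theorem integral_prod_gaussianMeasure_eq_pairSum {d m : ℕ} {R : Matrix (Fin d) (Fin d) ℝ}
    (hR : R.PosDef) [IsProbabilityMeasure (gaussianMeasure R)] (α : Fin m → Fin d)
    (B : Finset (Fin m)) :
    ∫ x : Fin d → ℝ, ∏ j ∈ B, x (α j) ∂gaussianMeasure R = pairSum (fun i j => R i j) α B := by
  induction B using Finset.strongInduction with
  | H B ih =>
    obtain rfl | hne := B.eq_empty_or_nonempty
    · simp [pairSum_empty (fun i j => R i j) α]
    have hmem := B.min'_mem hne
    rw [pairSum_eq_sum_erase _ α hmem fun k hk => B.min'_le k hk]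
    simp only [← Finset.mul_prod_erase B _ hmem]
    rw [integral_mul_prod_gaussianMeasure hR]
    refine Finset.sum_congr rfl fun j _ => ?_
    rw [ih _ ((Finset.erase_subset _ _).trans_ssubset (Finset.erase_ssubset hmem))]

theorem integrable_prod_pow_of_integrable_pow {Ω ι : Type*} [MeasurableSpace Ω] {P : Measure Ω}
    [IsFiniteMeasure P] {f : ι → Ω → ℝ} (hf : ∀ i, Measurable (f i))
    (hintegrable : ∀ (k : ℕ) (i : ι), Integrable (fun ω => f i ω ^ k) P) (S : Finset ι) (k : ℕ) :
    Integrable (fun ω => (∏ i ∈ S, f i ω) ^ k) P := by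
  induction S using Finset.induction_on generalizing k with
  | empty => simp
  | insert a S ha ih =>
    refine ((hintegrable (2 * k) a).add (ih (2 * k))).mono (by fun_prop)
      (Filter.Eventually.of_forall fun ω => ?_)
    simp only [Finset.prod_insert ha, Pi.add_apply, mul_pow, mul_comm 2 k, pow_mul]
    rw [Real.norm_eq_abs, Real.norm_of_nonneg (by positivity), abs_le]
    constructor <;>
    nlinarith [sq_nonneg (f a ω ^ k + (∏ i ∈ S, f i ω) ^ k),
      sq_nonneg (f a ω ^ k - (∏ i ∈ S, f i ω) ^ k)]

/-- **Isserlis theorem for a general Gaussian location mixture (even case)**: if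
`X = μ + ζ` with `μ` a random vector having moments of all orders and `ζ` a centered
Gaussian vector with covariance `R` independent of `μ`, and `A = {α₁,…,α_{2N}}`, then
`E[X_A] = ∑_{k=0}^{N} ∑_{S⊆A, |S|=2k} E[μ_S] ∑∏_{A∖S} E[ζ_i ζ_j]`. -/
theorem location_mixture_isserlis_even {d N : ℕ} {Ω : Type*} [MeasurableSpace Ω]
    (P : Measure Ω) [IsProbabilityMeasure P]
    (R : Matrix (Fin d) (Fin d) ℝ) (hR : R.PosDef)
    (μ : Ω → Fin d → ℝ) (hμm : Measurable μ)
    (hμmom : ∀ (k : ℕ) (i : Fin d), Integrable (fun ω => μ ω i ^ k) P)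
    (ζ : Ω → Fin d → ℝ) (hζm : Measurable ζ)
    (hζ : Measure.map ζ P = gaussianMeasure R)
    (hind : IndepFun μ ζ P)
    (X : Ω → Fin d → ℝ) (hX : ∀ ω i, X ω i = μ ω i + ζ ω i)
    (α : Fin (2 * N) → Fin d) :
    ∫ ω, ∏ i, X ω (α i) ∂P =
      ∑ k ∈ Finset.range (N + 1),
        ∑ S ∈ Finset.univ.powerset.filter (fun S : Finset (Fin (2 * N)) => S.card = 2 * k),
          (∫ ω, ∏ i ∈ S, μ ω (α i) ∂P) *
            pairSum (fun i j => ∫ ω, ζ ω i * ζ ω j ∂P) α (Finset.univ \ S) := by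
  have hgm : IsProbabilityMeasure (gaussianMeasure R) :=
    hζ ▸ Measure.isProbabilityMeasure_map hζm.aemeasurable
  have hC : (fun i j => ∫ ω, ζ ω i * ζ ω j ∂P) = fun i j => R i j := by
    ext i j
    rw [← integral_mul_gaussianMeasure hR i j, ← hζ,
      integral_map hζm.aemeasurable (by fun_prop)]
  have hζprod (B : Finset (Fin (2 * N))) :
      ∫ ω, ∏ j ∈ B, ζ ω (α j) ∂P = pairSum (fun i j => R i j) α B := by
    rw [← integral_prod_gaussianMeasure_eq_pairSum hR, ← hζ,
      integral_map hζm.aemeasurable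
        (by fun_prop : Measurable fun x : Fin d → ℝ => ∏ j ∈ B, x (α j)).aestronglyMeasurable]
  have hζint (B : Finset (Fin (2 * N))) : Integrable (fun ω => ∏ j ∈ B, ζ ω (α j)) P := by
    have h := integrable_prod_gaussianMeasure hR α B
    rw [← hζ] at h
    exact h.comp_measurable hζm
  have hμint (S : Finset (Fin (2 * N))) : Integrable (fun ω => ∏ i ∈ S, μ ω (α i)) P := by
    simpa using integrable_prod_pow_of_integrable_pow (f := fun i ω => μ ω (α i))
      (fun i => by fun_prop) (fun k i => hμmom k (α i)) S 1
  have hindep (S T : Finset (Fin (2 * N))) :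
      IndepFun (fun ω => ∏ i ∈ S, μ ω (α i)) (fun ω => ∏ j ∈ T, ζ ω (α j)) P :=
    hind.comp (φ := fun x : Fin d → ℝ => ∏ i ∈ S, x (α i))
      (ψ := fun x : Fin d → ℝ => ∏ j ∈ T, x (α j)) (by fun_prop) (by fun_prop)
  have hexpand : ∫ ω, ∏ i, X ω (α i) ∂P = ∑ S ∈ (Finset.univ : Finset (Fin (2 * N))).powerset,
      (∫ ω, ∏ i ∈ S, μ ω (α i) ∂P) * pairSum (fun i j => R i j) α (Finset.univ \ S) := by
    simp only [hX, Finset.prod_add]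
    have hintegrable (S : Finset (Fin (2 * N))) : Integrable (fun ω =>
        (∏ i ∈ S, μ ω (α i)) * ∏ j ∈ Finset.univ \ S, ζ ω (α j)) P :=
      (hindep S _).integrable_mul (hμint S) (hζint _)
    rw [integral_finsetSum _ fun S _ => hintegrable S]
    refine Finset.sum_congr rfl fun S _ => ?_
    rw [(hindep S _).integral_fun_mul_eq_mul_integral (hμint S).aestronglyMeasurable
      (hζint _).aestronglyMeasurable, hζprod]
  have hcard (S : Finset (Fin (2 * N))) : S.card ≤ 2 * N := by simpa using S.card_le_univ
  rw [hC, hexpand, ← Finset.sum_filter_of_ne (p := fun S => Even S.card) fun S _ hS => ?_,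
    ← Finset.sum_fiberwise_of_maps_to (t := Finset.range (N + 1)) (g := fun S => S.card / 2)
      fun S _ => Finset.mem_range.2 (by have := hcard S; omega)]
  · refine Finset.sum_congr rfl fun k _ => Finset.sum_congr ?_ fun _ _ => rfl
    ext S
    simp only [Finset.mem_filter, and_assoc, and_congr_right_iff]
    intro _
    rw [Nat.even_iff]
    omega
  · by_contra hodd
    refine hS (mul_eq_zero_of_right _ (pairSum_eq_zero_of_odd_card _ α _ ?_))
    have := hcard S
    rw [Finset.card_sdiff_of_subset (Finset.subset_univ S), Finset.card_univ, Fintype.card_fin]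
    grind
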